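/- arXiv:1508.02438 — 4 statements merged into one kernel-verified Lean document; each statement's English description precedes it below -/
import Mathlib

section
/- Let V be a finite set and F : V → Set V a combinatorial multivalued map. Let M ⊆ V be a strongly connected set of vertices in the sense that for all m, m' ∈ M there is a path m ⇝ m' (in particular every m ∈ M admits a path from itself to itself). Then the forward reachable set ↓M := {v ∈ V : ∃ m ∈ M, m ⇝ v} is an attractor for F, i.e. F(↓M) = ↓M. -/
/-- If `M ⊆ V` is strongly connected (every two of its elements are joined
by a path, in particular every `m ∈ M` has a path from itself to itself), then the
forward reachable set `↓M = {v | ∃ m ∈ M, m ⇝ v}` is an attractor for `F`: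
`F(↓M) = ↓M`. -/
theorem downset_of_morse_set_is_attractor {V : Type*} [Fintype V] (F : V → Set V)
    (M : Set V)
    (hM : ∀ m ∈ M, ∀ m' ∈ M, Relation.TransGen (fun a b => b ∈ F a) m m') :
    (⋃ u ∈ {v : V | ∃ m ∈ M, Relation.TransGen (fun a b => b ∈ F a) m v}, F u)
      = {v : V | ∃ m ∈ M, Relation.TransGen (fun a b => b ∈ F a) m v} := by
  ext v
  simp only [Set.mem_iUnion, Set.mem_ofPred_eq, exists_prop]
  constructor
  · rintro ⟨u, ⟨m, hm, hmu⟩, huv⟩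
    exact ⟨m, hm, hmu.tail huv⟩
  · rintro ⟨m, hm, hmv⟩
    cases hmv with
    | single hv => exact ⟨m, ⟨m, hm, hM m hm m hm⟩, hv⟩
    | tail hmu huv => exact ⟨_, ⟨m, hm, hmu⟩, huv⟩
end

section
/- Let γ₁, γ₂ > 0 and γ̄ := min(γ₁/γ₂, γ₂/γ₁); let λ, μ, ρ > 0, a ≥ 2λ, and p, q ∈ ℝ with |p| ≤ ρ and μ ≤ q ≤ ρ. For t ∈ [0,1] set L(t) := (γ₁ − γ₂)(a/2)t − γ₁p − γ₂q and M := (a/2)γ₂q. If L(t) < 0, then −M/L(t) ≥ λμγ̄/(λ + 2ρ). -/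
/-- The smaller of the two ratios of positive numbers, times their maximum, is their minimum. -/
theorem min_div_div_mul_max {x y : ℝ} (hx : 0 < x) (hy : 0 < y) :
    min (x / y) (y / x) * max x y = min x y := by
  rcases le_total x y with h | h
  · have h' : x / y ≤ y / x := by
      rw [div_le_div_iff₀ hy hx]
      exact mul_self_le_mul_self hx.le h
    rw [min_eq_left h', max_eq_right h, min_eq_left h, div_mul_cancel₀ _ hy.ne']
  · have h' : y / x ≤ x / y := by
      rw [div_le_div_iff₀ hx hy]
      exact mul_self_le_mul_self hy.le h
    rw [min_eq_right h', max_eq_left h, min_eq_right h, div_mul_cancel₀ _ hx.ne']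

/-- The narrow-chip estimate: with `γ̄ = min(γ₁/γ₂, γ₂/γ₁)`, `a ≥ 2λ`,
`|p| ≤ ρ`, `μ ≤ q ≤ ρ`, `L(t) = (γ₁-γ₂)(a/2)t - γ₁p - γ₂q` and `M = (a/2)γ₂q`, if
`L(t) < 0` then `-M/L(t) ≥ λμγ̄/(λ + 2ρ)`. -/
theorem narrow_chip_ratio_bound
    (γ₁ γ₂ lam μ ρ a p q t : ℝ)
    (hγ₁ : 0 < γ₁) (hγ₂ : 0 < γ₂)
    (hlam : 0 < lam) (hμ : 0 < μ) (hρ : 0 < ρ)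
    (ha : 2 * lam ≤ a) (hp : |p| ≤ ρ) (hq₁ : μ ≤ q) (hq₂ : q ≤ ρ)
    (ht : t ∈ Set.Icc (0:ℝ) 1)
    (hL : (γ₁ - γ₂) * (a / 2) * t - γ₁ * p - γ₂ * q < 0) :
    -((a / 2) * γ₂ * q) / ((γ₁ - γ₂) * (a / 2) * t - γ₁ * p - γ₂ * q)
      ≥ lam * μ * min (γ₁ / γ₂) (γ₂ / γ₁) / (lam + 2 * ρ) := by
  obtain ⟨ht₀, ht₁⟩ := ht
  have hq : 0 < q := hμ.trans_le hq₁
  have hratio : min (γ₁ / γ₂) (γ₂ / γ₁) * max γ₁ γ₂ ≤ γ₂ :=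
    (min_div_div_mul_max hγ₁ hγ₂).trans_le (min_le_right _ _)
  have hmin : 0 < min (γ₁ / γ₂) (γ₂ / γ₁) := lt_min (by positivity) (by positivity)
  have h₁ : γ₁ ≤ max γ₁ γ₂ := le_max_left _ _
  have h₂ : γ₂ ≤ max γ₁ γ₂ := le_max_right _ _
  generalize min (γ₁ / γ₂) (γ₂ / γ₁) = m at *
  generalize max γ₁ γ₂ = G at *
  obtain ⟨b, rfl⟩ : ∃ b, a = 2 * b := ⟨a / 2, by ring⟩
  rw [mul_div_cancel_left₀ b two_ne_zero] at *
  have hb : lam ≤ b := by linarith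
  have hb₀ : 0 < b := hlam.trans_le hb
  have hG : 0 < G := hγ₂.trans_le h₂
  have hL_bound : -((γ₁ - γ₂) * b * t - γ₁ * p - γ₂ * q) ≤ G * (b + 2 * ρ) := by
    have hp' : γ₁ * p ≤ G * ρ :=
      mul_le_mul_of_nonneg h₁ ((le_abs_self p).trans hp) hγ₁.le hρ.le
    have hq' : γ₂ * q ≤ G * ρ := mul_le_mul h₂ hq₂ hq.le hG.le
    have ht' : (γ₂ - γ₁) * (b * t) ≤ G * b :=
      mul_le_mul (by linarith) (mul_le_of_le_one_right hb₀.le ht₁) (by positivity)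
        hG.le
    linarith
  rw [ge_iff_le, neg_div, ← div_neg, div_le_div_iff₀ (by positivity) (neg_pos.mpr hL)]
  calc lam * μ * m * -((γ₁ - γ₂) * b * t - γ₁ * p - γ₂ * q)
      ≤ lam * μ * m * (G * (b + 2 * ρ)) := by gcongr
    _ = μ * (m * G) * (lam * b + lam * (2 * ρ)) := by ring
    _ ≤ q * γ₂ * (lam * b + b * (2 * ρ)) := by gcongr
    _ = b * γ₂ * q * (lam + 2 * ρ) := by ring
end

section
/- Let γ₁, γ₂ > 0 and γ̄ := min(γ₁/γ₂, γ₂/γ₁); let λ, μ, ρ > 0, a ≥ 2λ, and p, q ∈ ℝ with |p| ≤ ρ and μ ≤ q ≤ ρ. For t ∈ [0,1] set K(t) := (1−t)γ₁ + tγ₂, L(t) := (γ₁ − γ₂)(a/2)t − γ₁p − γ₂q, and M := (a/2)γ₂q. Then for every δ with 0 < δ < λμγ̄/(λ + 2ρ) and every t ∈ [0,1], K(t)δ² + L(t)δ + M > 0. (This is the analytic core of the narrow-chip case of the chip transversality proposition: the vector field −Γ(x − Φ*) is transverse in to the narrow chip along its hypotenuse for all such δ.) -/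
/-- The analytic core of the narrow-chip transversality: with
`K(t) = (1-t)γ₁ + tγ₂`, `L(t) = (γ₁-γ₂)(a/2)t - γ₁p - γ₂q`, `M = (a/2)γ₂q`, for every
`0 < δ < λμγ̄/(λ + 2ρ)` and every `t ∈ [0,1]`, `K(t)δ² + L(t)δ + M > 0`. -/
theorem narrow_chip_transversality
    (γ₁ γ₂ lam μ ρ a p q : ℝ)
    (hγ₁ : 0 < γ₁) (hγ₂ : 0 < γ₂)
    (hlam : 0 < lam) (hμ : 0 < μ) (hρ : 0 < ρ)
    (ha : 2 * lam ≤ a) (hp : |p| ≤ ρ) (hq₁ : μ ≤ q) (hq₂ : q ≤ ρ) :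
    ∀ δ : ℝ, 0 < δ →
      δ < lam * μ * min (γ₁ / γ₂) (γ₂ / γ₁) / (lam + 2 * ρ) →
      ∀ t ∈ Set.Icc (0:ℝ) 1,
        0 < ((1 - t) * γ₁ + t * γ₂) * δ ^ 2
            + ((γ₁ - γ₂) * (a / 2) * t - γ₁ * p - γ₂ * q) * δ
            + (a / 2) * γ₂ * q := by
  intro δ hδ hlt t ⟨ht₀, ht₁⟩
  have hp₂ : p ≤ ρ := (abs_le.mp hp).2
  rw [lt_div_iff₀ (by positivity)] at hlt
  obtain ⟨m, hm₁, hm₂, hγ⟩ : ∃ m, γ₁ ≤ m ∧ γ₂ ≤ m ∧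
      min (γ₁ / γ₂) (γ₂ / γ₁) * m ≤ γ₂ := by
    rcases le_total γ₁ γ₂ with h | h
    · refine ⟨γ₂, h, le_rfl, ?_⟩
      calc min (γ₁ / γ₂) (γ₂ / γ₁) * γ₂ ≤ γ₁ / γ₂ * γ₂ := by gcongr; exact min_le_left _ _
        _ = γ₁ := by field_simp
        _ ≤ γ₂ := h
    · refine ⟨γ₁, le_rfl, h, ?_⟩
      calc min (γ₁ / γ₂) (γ₂ / γ₁) * γ₁ ≤ γ₂ / γ₁ * γ₁ := by gcongr; exact min_le_right _ _
        _ = γ₂ := by field_simp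
  have hm : 0 < m := hγ₁.trans_le hm₁
  obtain ⟨b, rfl⟩ : ∃ b, a = 2 * b := ⟨a / 2, by ring⟩
  have hb : lam ≤ b := by linarith
  have hb₀ : 0 < b := hlam.trans_le hb
  have hδm : m * (δ * (lam + 2 * ρ)) < lam * μ * γ₂ :=
    calc m * (δ * (lam + 2 * ρ)) < m * (lam * μ * min (γ₁ / γ₂) (γ₂ / γ₁)) := by gcongr
      _ = lam * μ * (min (γ₁ / γ₂) (γ₂ / γ₁) * m) := by ring
      _ ≤ lam * μ * γ₂ := by gcongr
  have hwidth : m * δ * (b + 2 * ρ) < b * γ₂ * q := by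
    refine lt_of_mul_lt_mul_left ?_ hlam.le
    calc lam * (m * δ * (b + 2 * ρ)) = m * δ * (lam * b + lam * (2 * ρ)) := by ring
      _ ≤ m * δ * (lam * b + b * (2 * ρ)) := by gcongr
      _ = b * (m * (δ * (lam + 2 * ρ))) := by ring
      _ < b * (lam * μ * γ₂) := by gcongr
      _ ≤ b * (lam * q * γ₂) := by gcongr
      _ = lam * (b * γ₂ * q) := by ring
  have hslope : -(m * b) ≤ (γ₁ - γ₂) * b * t := by
    have h₁ : γ₂ * (b * t) ≤ m * (b * 1) := by gcongr
    have h₂ : 0 ≤ γ₁ * (b * t) := by positivity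
    linarith
  have h₁ : γ₁ * p ≤ m * ρ := by
    calc γ₁ * p ≤ γ₁ * ρ := by gcongr
      _ ≤ m * ρ := by gcongr
  have h₂ : γ₂ * q ≤ m * ρ := by
    calc γ₂ * q ≤ γ₂ * ρ := by gcongr
      _ ≤ m * ρ := by gcongr
  have hL : -(m * (b + 2 * ρ)) * δ ≤ ((γ₁ - γ₂) * b * t - γ₁ * p - γ₂ * q) * δ := by
    gcongr
    linarith
  have hK : 0 ≤ ((1 - t) * γ₁ + t * γ₂) * δ ^ 2 := by
    have := sub_nonneg.mpr ht₁
    positivity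
  rw [mul_div_cancel_left₀ b two_ne_zero]
  linarith
end

section
/- Let γ₁, γ₂ > 0 and γ̄ := min(γ₁/γ₂, γ₂/γ₁); let λ, μ, ρ > 0, a ≥ 2λ, and p, q ∈ ℝ with 0 ≤ p ≤ ρ and μ ≤ q ≤ ρ. For t ∈ [0,1] set K(t) := 2γ₁ − γ₂ − 2(γ₁ − γ₂)t, L(t) := (γ₁ − γ₂)a t + (a/2)γ₂ − 2γ₁p − γ₂q, and M := (a/2)γ₂q. Define δ* := min{ λμγ̄/(√2(2λ + 3ρ)), √(λμγ̄/32) }. Then for every δ with 0 < δ < δ* and every t ∈ [0,1], K(t)δ² + L(t)δ + M > 0. (This is the analytic core of the wide-chip case of the chip transversality proposition: the vector field −Γ(x − Φ*) is transverse in to the wide chip along its hypotenuse for all 0 < δ < δ*.) -/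
/-- The analytic core of the wide-chip transversality: with
`K(t) = 2γ₁ - γ₂ - 2(γ₁-γ₂)t`, `L(t) = (γ₁-γ₂)at + (a/2)γ₂ - 2γ₁p - γ₂q`,
`M = (a/2)γ₂q`, and `δ* = min(λμγ̄/(√2(2λ+3ρ)), √(λμγ̄/32))`, for every `0 < δ < δ*`
and every `t ∈ [0,1]`, `K(t)δ² + L(t)δ + M > 0`. -/
theorem wide_chip_transversality
    (γ₁ γ₂ lam μ ρ a p q : ℝ)
    (hγ₁ : 0 < γ₁) (hγ₂ : 0 < γ₂)
    (hlam : 0 < lam) (hμ : 0 < μ) (hρ : 0 < ρ)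
    (ha : 2 * lam ≤ a) (hp₀ : 0 ≤ p) (hp₁ : p ≤ ρ) (hq₁ : μ ≤ q) (hq₂ : q ≤ ρ) :
    ∀ δ : ℝ, 0 < δ →
      δ < min (lam * μ * min (γ₁ / γ₂) (γ₂ / γ₁)
                / (Real.sqrt 2 * (2 * lam + 3 * ρ)))
              (Real.sqrt (lam * μ * min (γ₁ / γ₂) (γ₂ / γ₁) / 32)) →
      ∀ t ∈ Set.Icc (0:ℝ) 1,
        0 < (2 * γ₁ - γ₂ - 2 * (γ₁ - γ₂) * t) * δ ^ 2
            + ((γ₁ - γ₂) * a * t + (a / 2) * γ₂ - 2 * γ₁ * p - γ₂ * q) * δ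
            + (a / 2) * γ₂ * q := by
  intro δ hδ hδ' t ⟨ht₀, ht₁⟩
  have hg := hδ'.trans_le (min_le_left _ _)
  set g := min (γ₁ / γ₂) (γ₂ / γ₁)
  have hg₂ : g * γ₂ ≤ γ₁ := (le_div_iff₀ hγ₂).1 (min_le_left _ _)
  have hg₁ : g * γ₁ ≤ γ₂ := (le_div_iff₀ hγ₁).1 (min_le_right _ _)
  have hs : (1 : ℝ) ≤ Real.sqrt 2 := Real.one_le_sqrt.2 (by norm_num)
  have hw : 0 < 2 * lam + 3 * ρ := by positivity
  rw [lt_div_iff₀ (by positivity)] at hg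
  have hδw : 0 < δ * (2 * lam + 3 * ρ) := by positivity
  have hlm : 0 < lam * μ := by positivity
  have hD : δ * (2 * lam + 3 * ρ) < lam * μ * g := by
    nlinarith
  have hA : γ₁ * (δ * (2 * lam + 3 * ρ)) < lam * μ * γ₂ := by
    nlinarith [mul_lt_mul_of_pos_left hD hγ₁, mul_le_mul_of_nonneg_left hg₁ hlm.le]
  have hg_le : g ≤ 1 := by
    by_contra! h
    nlinarith
  have hB : δ * (2 * lam + 3 * ρ) < lam * μ := by nlinarith
  have hμρ : μ ≤ ρ := hq₁.trans hq₂
  have hδμ : δ < μ := by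
    by_contra! h
    nlinarith [mul_pos hδ hρ]
  have hδlam : δ < lam := by
    by_contra! h
    nlinarith [mul_pos hδ hlam, mul_le_mul_of_nonneg_left hμρ hlam.le]
  have hγB := mul_lt_mul_of_pos_left hB hγ₂
  have hγ₁δ : 0 < γ₁ * δ := by positivity
  have hγ₂δ : 0 < γ₂ * δ := by positivity
  have hpρ := mul_le_mul_of_nonneg_left hp₁ hγ₁δ.le
  have hqρ := mul_le_mul_of_nonneg_left hq₂ hγ₂δ.le
  have hμq := mul_le_mul_of_nonneg_left hq₁ (mul_pos hlam hγ₂).le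
  have hδsq := mul_lt_mul_of_pos_left hδlam hγ₂δ
  have hq : 0 < q := hμ.trans_le hq₁
  have hγ₁lam : 0 < γ₁ * δ * lam := by positivity
  have hγ₁sq : 0 < γ₁ * δ * δ := by positivity
  have hγ₂sq : 0 < γ₂ * δ * δ := by positivity
  -- The expression is affine in `t`, so positivity at the two endpoints suffices.
  have h₀ : 0 < (2 * γ₁ - γ₂) * δ ^ 2 + ((a / 2) * γ₂ - 2 * γ₁ * p - γ₂ * q) * δ
      + (a / 2) * γ₂ * q := by
    have hslope : 0 ≤ (a - 2 * lam) * (γ₂ * (δ + q)) :=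
      mul_nonneg (by linarith) (by positivity)
    linarith
  have h₁ : 0 < γ₂ * δ ^ 2 + ((γ₁ - γ₂ / 2) * a - 2 * γ₁ * p - γ₂ * q) * δ
      + (a / 2) * γ₂ * q := by
    have hslope : 0 ≤ (a - 2 * lam) * (2 * (γ₁ * δ) + γ₂ * (q - δ)) :=
      mul_nonneg (by linarith)
        (add_nonneg (by positivity) (mul_nonneg hγ₂.le (by linarith)))
    rcases le_total γ₁ γ₂ with h | h
    · linarith [mul_le_mul_of_nonneg_right h (mul_pos hδ hρ).le]
    · linarith [mul_le_mul_of_nonneg_right h (mul_pos hδ hlam).le]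
  rcases ht₀.eq_or_lt with rfl | ht
  · linarith
  · linarith [mul_nonneg (sub_nonneg.2 ht₁) h₀.le, mul_pos ht h₁]
end
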